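/- arXiv:2112.15473 — 2 statements merged into one kernel-verified Lean document; each statement's English description precedes it below -/
import Mathlib

section
/- Let g : ℝⁿ → Matrix (Fin n) (Fin n) ℝ be C^∞ with g(x) symmetric and positive definite for every x, let f : ℝⁿ → ℝⁿ be a C^∞ diffeomorphism which is an isometry of g, i.e. (f*g)(x) = g(x) for all x, and let φ : ℝⁿ → ℝ be C^∞. If Δ_g φ(x) = 0 for all x ∈ ℝⁿ, then Δ_g(φ ∘ f)(x) = 0 for all x ∈ ℝⁿ. In other words, isometries of the metric g act on the space of solutions of Laplace's equation Δ_g φ = 0. (Corollary: isometries of g act on solutions of the equations of motion of a generally covariant theory, stated for the free scalar field in coordinates.) -/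
open Matrix

/-- The `μ`-th coordinate partial derivative `∂_μ ψ (x) = fderiv ℝ ψ x (e_μ)`. -/
noncomputable def pd (n : ℕ) (μ : Fin n) (ψ : (Fin n → ℝ) → ℝ) (x : Fin n → ℝ) : ℝ :=
  fderiv ℝ ψ x (Pi.single μ 1)

/-- The coordinate Laplace–Beltrami operator
`Δ_g φ (x) = (det g x)^(-1/2) ∑_μ ∂_μ ( y ↦ (det g y)^(1/2) ∑_ν (g y)⁻¹ μ ν ∂_ν φ y ) x`. -/
noncomputable def lapBel (n : ℕ) (g : (Fin n → ℝ) → Matrix (Fin n) (Fin n) ℝ)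
    (φ : (Fin n → ℝ) → ℝ) (x : Fin n → ℝ) : ℝ :=
  (Real.sqrt (g x).det)⁻¹ *
    ∑ μ, pd n μ (fun y => Real.sqrt (g y).det * ∑ ν, (g y)⁻¹ μ ν * pd n ν φ y) x

/-- The Jacobian matrix of `f` at `x`: the matrix of `fderiv ℝ f x` in the standard basis. -/
noncomputable def jacobian (n : ℕ) (f : (Fin n → ℝ) → (Fin n → ℝ)) (x : Fin n → ℝ) :
    Matrix (Fin n) (Fin n) ℝ :=
  Matrix.of fun i j => fderiv ℝ f x (Pi.single j 1) i

/-- The pullback metric `(f*g)(x) = (Df x)ᵀ * g (f x) * Df x`. -/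
noncomputable def pullbackMet (n : ℕ) (f : (Fin n → ℝ) → (Fin n → ℝ))
    (g : (Fin n → ℝ) → Matrix (Fin n) (Fin n) ℝ) (x : Fin n → ℝ) :
    Matrix (Fin n) (Fin n) ℝ :=
  (jacobian n f x)ᵀ * g (f x) * jacobian n f x

theorem hasFDerivAt_det_aux {n : ℕ} {a : (Fin n → ℝ) → Matrix (Fin n) (Fin n) ℝ} {x : Fin n → ℝ}
    (h : ∀ i j, DifferentiableAt ℝ (fun y => a y i j) x) :
    HasFDerivAt (fun y => (a y).det)
      (∑ i, ∑ k, (a x).adjugate i k • fderiv ℝ (fun y => a y k i) x) x := by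
  have h1 : HasFDerivAt (fun y => (a y).det)
      (∑ σ : Equiv.Perm (Fin n), ((Equiv.Perm.sign σ : ℤ) : ℝ) •
        ∑ i, (∏ j ∈ Finset.univ.erase i, a x (σ j) j) • fderiv ℝ (fun y => a y (σ i) i) x) x := by
    simp only [Matrix.det_apply']
    refine HasFDerivAt.fun_sum fun σ _ => ?_
    refine HasFDerivAt.const_mul ?_ _
    exact HasFDerivAt.finset_prod fun i _ => (h (σ i) i).hasFDerivAt
  convert h1 using 1
  ext v
  simp only [ContinuousLinearMap.sum_apply, ContinuousLinearMap.smul_apply, smul_eq_mul,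
    Finset.mul_sum]
  rw [Finset.sum_comm (s := (Finset.univ : Finset (Equiv.Perm (Fin n))))]
  refine Finset.sum_congr rfl fun i _ => ?_
  have h2 : ∑ k, (a x).adjugate i k * fderiv ℝ (fun y => a y k i) x v =
      ((a x).updateCol i (fun k => fderiv ℝ (fun y => a y k i) x v)).det := by
    rw [← Matrix.cramer_apply, Matrix.cramer_eq_adjugate_mulVec]
    rfl
  rw [h2, Matrix.det_apply']
  refine Finset.sum_congr rfl fun σ _ => ?_
  rw [← Finset.mul_prod_erase Finset.univ _ (Finset.mem_univ i)]
  simp only [Matrix.updateCol_self]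
  rw [mul_comm (∏ j ∈ Finset.univ.erase i, a x (σ j) j)]
  congr 2
  refine Finset.prod_congr rfl fun j hj => ?_
  rw [Matrix.updateCol_ne (Finset.ne_of_mem_erase hj)]

theorem diff_inv_aux {n : ℕ} {a : (Fin n → ℝ) → Matrix (Fin n) (Fin n) ℝ} {x : Fin n → ℝ}
    (h : ∀ i j, DifferentiableAt ℝ (fun y => a y i j) x) (h0 : (a x).det ≠ 0) (i j : Fin n) :
    DifferentiableAt ℝ (fun y => (a y)⁻¹ i j) x := by
  simp only [Matrix.inv_def, Ring.inverse_eq_inv', Matrix.smul_apply, smul_eq_mul,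
    Matrix.adjugate_apply]
  refine DifferentiableAt.mul ((hasFDerivAt_det_aux h).differentiableAt.inv h0) ?_
  refine (hasFDerivAt_det_aux (a := fun y => (a y).updateRow j (Pi.single i 1)) fun k l => ?_).differentiableAt
  by_cases hk : k = j
  · subst hk; simp
  · simpa [Matrix.updateRow_ne hk] using h k l

theorem pd_mul_aux {n : ℕ} (μ : Fin n) {u v : (Fin n → ℝ) → ℝ} {x : Fin n → ℝ}
    (hu : DifferentiableAt ℝ u x) (hv : DifferentiableAt ℝ v x) :
    pd n μ (fun y => u y * v y) x = pd n μ u x * v x + u x * pd n μ v x := by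
  simp only [pd]
  rw [fderiv_fun_mul hu hv]
  simp; ring

theorem pd_sum_aux {n : ℕ} (μ : Fin n) {u : Fin n → (Fin n → ℝ) → ℝ} {x : Fin n → ℝ}
    (hu : ∀ i, DifferentiableAt ℝ (u i) x) :
    pd n μ (fun y => ∑ i, u i y) x = ∑ i, pd n μ (u i) x := by
  simp only [pd]
  rw [fderiv_fun_sum fun i _ => hu i]
  simp

theorem clm_expand_aux {n : ℕ} {F : Type*} [NormedAddCommGroup F] [NormedSpace ℝ F]
    (L : (Fin n → ℝ) →L[ℝ] F) (v : Fin n → ℝ) :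
    L v = ∑ i, v i • L (Pi.single i 1) := by
  conv_lhs => rw [pi_eq_sum_univ' v]
  simp only [map_sum, map_smul]

theorem pd_comp_aux {n : ℕ} (μ : Fin n) {u : (Fin n → ℝ) → ℝ} {f : (Fin n → ℝ) → (Fin n → ℝ)}
    {x : Fin n → ℝ} (hu : DifferentiableAt ℝ u (f x)) (hf : DifferentiableAt ℝ f x) :
    pd n μ (fun y => u (f y)) x = ∑ b, pd n b u (f x) * jacobian n f x b μ := by
  have : fderiv ℝ (fun y => u (f y)) x = (fderiv ℝ u (f x)).comp (fderiv ℝ f x) :=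
    fderiv_comp x hu hf
  simp only [pd, this, ContinuousLinearMap.comp_apply]
  rw [clm_expand_aux (fderiv ℝ u (f x))]
  simp [jacobian, mul_comm]

theorem jac_contDiff_aux {n : ℕ} {f : (Fin n → ℝ) → (Fin n → ℝ)}
    (hf : ContDiff ℝ (⊤ : ℕ∞) f) (i j : Fin n) :
    ContDiff ℝ (⊤ : ℕ∞) (fun y => jacobian n f y i j) := by
  have h1 : ContDiff ℝ (⊤ : ℕ∞) (fun y => fderiv ℝ f y (Pi.single j 1)) :=
    (hf.fderiv_right (m := (⊤ : ℕ∞)) (by simp)).clm_apply contDiff_const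
  exact (contDiff_pi.1 h1) i

theorem jac_symm_aux {n : ℕ} {f : (Fin n → ℝ) → (Fin n → ℝ)}
    (hf : ContDiff ℝ (⊤ : ℕ∞) f) (i j k : Fin n) (x : Fin n → ℝ) :
    pd n k (fun y => jacobian n f y i j) x = pd n j (fun y => jacobian n f y i k) x := by
  have hs : IsSymmSndFDerivAt ℝ f x :=
    hf.contDiffAt.isSymmSndFDerivAt (by simp; exact WithTop.coe_le_coe.2 (le_top : (2 : ℕ∞) ≤ ⊤))
  have hd : DifferentiableAt ℝ (fderiv ℝ f) x :=
    ((hf.fderiv_right (m := (⊤ : ℕ∞)) (by simp)).differentiable (by simp)) x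
  have key : ∀ j k, pd n k (fun y => jacobian n f y i j) x =
      fderiv ℝ (fderiv ℝ f) x (Pi.single k 1) (Pi.single j 1) i := by
    intro j k
    have h1 : HasFDerivAt (fun y => fderiv ℝ f y (Pi.single j 1))
        ((fderiv ℝ (fderiv ℝ f) x).flip (Pi.single j 1)) x := by
      simpa using hd.hasFDerivAt.clm_apply (hasFDerivAt_const (Pi.single j (1:ℝ)) x)
    have h2 := (hasFDerivAt_pi'.1 h1) i
    have : fderiv ℝ (fun y => jacobian n f y i j) x = _ := h2.fderiv
    simp only [pd, this]
    rfl
  rw [key, key, hs]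

theorem jac_mul_aux {n : ℕ} {f f_inv : (Fin n → ℝ) → (Fin n → ℝ)}
    (hf : Differentiable ℝ f) (hf_inv : Differentiable ℝ f_inv)
    (hleft : Function.LeftInverse f_inv f) (x : Fin n → ℝ) :
    jacobian n f_inv (f x) * jacobian n f x = 1 := by
  have h1 : (fderiv ℝ f_inv (f x)).comp (fderiv ℝ f x) = ContinuousLinearMap.id ℝ _ := by
    rw [← fderiv_comp x (hf_inv _) (hf _)]
    have : f_inv ∘ f = id := funext hleft
    rw [this, fderiv_id]
  ext i j
  have h2 := congrFun (congrArg (fun L => L (Pi.single j 1)) h1) i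
  simp only [ContinuousLinearMap.comp_apply] at h2
  rw [clm_expand_aux (fderiv ℝ f_inv (f x))] at h2
  simp only [Matrix.mul_apply, jacobian, Matrix.of_apply]
  simp only [Finset.sum_apply, Pi.smul_apply, smul_eq_mul] at h2
  simp only [mul_comm]
  rw [h2]
  simp [Pi.single_apply, Matrix.one_apply]

theorem div_pull_aux {n : ℕ} {f f_inv : (Fin n → ℝ) → (Fin n → ℝ)}
    (hf : ContDiff ℝ (⊤ : ℕ∞) f) (hf_inv : ContDiff ℝ (⊤ : ℕ∞) f_inv)
    (hleft : Function.LeftInverse f_inv f)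
    (V : Fin n → (Fin n → ℝ) → ℝ) (hV : ∀ a, Differentiable ℝ (V a)) (x : Fin n → ℝ) :
    ∑ μ, pd n μ (fun y => |(jacobian n f y).det| *
      ∑ a, jacobian n f_inv (f y) μ a * V a (f y)) x =
    |(jacobian n f x).det| * ∑ a, pd n a (V a) (f x) := by
  have hfd : Differentiable ℝ f := hf.differentiable (by simp)
  have hfid : Differentiable ℝ f_inv := hf_inv.differentiable (by simp)
  have hKJ := jac_mul_aux hfd hfid hleft
  have hJK : ∀ y, jacobian n f y * jacobian n f_inv (f y) = 1 := fun y =>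
    mul_eq_one_comm.1 (hKJ y)
  have hJd : ∀ i j, Differentiable ℝ (fun y => jacobian n f y i j) := fun i j =>
    (jac_contDiff_aux hf i j).differentiable (by simp)
  have hKd : ∀ i j, Differentiable ℝ (fun y => jacobian n f_inv (f y) i j) := fun i j =>
    ((jac_contDiff_aux hf_inv i j).comp hf).differentiable (by simp)
  have hVd : ∀ a, Differentiable ℝ (fun y => V a (f y)) := fun a => (hV a).comp hfd
  have hD0 : (jacobian n f x).det ≠ 0 := by
    intro h
    have := congrArg Matrix.det (hJK x)
    simp [h] at this
  have hadj : (jacobian n f x).adjugate = (jacobian n f x).det • jacobian n f_inv (f x) := by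
    calc _ = (jacobian n f x).adjugate * (jacobian n f x * jacobian n f_inv (f x)) := by
            rw [hJK, mul_one]
      _ = _ := by rw [← mul_assoc, Matrix.adjugate_mul, Matrix.smul_mul, one_mul]
  have hdet := hasFDerivAt_det_aux (x := x) fun i j => (hJd i j) x
  have habs := (hasDerivAt_abs hD0).comp_hasFDerivAt x hdet
  change HasFDerivAt (fun y => |(jacobian n f y).det|) _ x at habs
  -- derivative of |D|
  have hA : ∀ c, pd n c (fun y => |(jacobian n f y).det|) x = |(jacobian n f x).det| *
      ∑ i, ∑ k, jacobian n f_inv (f x) i k * pd n c (fun y => jacobian n f y k i) x := by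
    intro c
    simp only [pd, habs.fderiv, hadj]
    simp only [ContinuousLinearMap.smul_apply, ContinuousLinearMap.sum_apply, smul_eq_mul,
      Matrix.smul_apply, mul_assoc, ← Finset.mul_sum]
    rw [← mul_assoc, sign_mul_self]
  -- derivative of K
  have hK : ∀ c i a, pd n c (fun y => jacobian n f_inv (f y) i a) x =
      - ∑ d, (∑ b, jacobian n f_inv (f x) i b * pd n c (fun y => jacobian n f y b d) x) *
        jacobian n f_inv (f x) d a := by
    intro c i a
    have h1 : ∀ d, ∑ b, (pd n c (fun y => jacobian n f_inv (f y) i b) x * jacobian n f x b d +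
        jacobian n f_inv (f x) i b * pd n c (fun y => jacobian n f y b d) x) = 0 := by
      intro d
      have h2 : (fun y => ∑ b, jacobian n f_inv (f y) i b * jacobian n f y b d) =
          fun _ => (1 : Matrix (Fin n) (Fin n) ℝ) i d := by
        funext y
        rw [← hKJ y, Matrix.mul_apply]
      have h3 : pd n c (fun y => ∑ b, jacobian n f_inv (f y) i b * jacobian n f y b d) x = 0 := by
        rw [h2]; simp [pd]
      rw [pd_sum_aux c fun b => ((hKd i b) x).fun_mul ((hJd b d) x)] at h3
      rw [← h3]
      exact Finset.sum_congr rfl fun b _ => (pd_mul_aux c (hKd i b x) (hJd b d x)).symm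
    have h4 : ∀ d, (∑ b, jacobian n f_inv (f x) i b * pd n c (fun y => jacobian n f y b d) x) =
        - ∑ b, pd n c (fun y => jacobian n f_inv (f y) i b) x * jacobian n f x b d := by
      intro d
      have := h1 d
      rw [Finset.sum_add_distrib] at this
      linarith
    simp only [h4, neg_mul, Finset.sum_neg_distrib, neg_neg, Finset.sum_mul]
    rw [Finset.sum_comm]
    simp only [mul_assoc, ← Finset.mul_sum]
    have h5 : ∀ b, ∑ d, jacobian n f x b d * jacobian n f_inv (f x) d a =
        (1 : Matrix (Fin n) (Fin n) ℝ) b a := fun b => by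
      rw [← hJK x, Matrix.mul_apply]
    simp [h5, Matrix.one_apply]
  -- contracted
  have hP : ∀ a, ∑ μ, pd n μ (fun y => jacobian n f_inv (f y) μ a) x =
      - ∑ c, (∑ i, ∑ k, jacobian n f_inv (f x) i k * pd n c (fun y => jacobian n f y k i) x) *
        jacobian n f_inv (f x) c a := by
    intro a
    simp only [hK, Finset.sum_neg_distrib]
    rw [Finset.sum_comm]
    congr 1
    refine Finset.sum_congr rfl fun d _ => ?_
    rw [← Finset.sum_mul]
    congr 1
    refine Finset.sum_congr rfl fun i _ => Finset.sum_congr rfl fun k _ => ?_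
    rw [jac_symm_aux hf]
  have hmain : ∀ μ, pd n μ (fun y => |(jacobian n f y).det| *
      ∑ a, jacobian n f_inv (f y) μ a * V a (f y)) x =
      ∑ a, (|(jacobian n f x).det| * (∑ i, ∑ k, jacobian n f_inv (f x) i k *
        pd n μ (fun y => jacobian n f y k i) x) * (jacobian n f_inv (f x) μ a * V a (f x)) +
      |(jacobian n f x).det| * (pd n μ (fun y => jacobian n f_inv (f y) μ a) x * V a (f x) +
        jacobian n f_inv (f x) μ a * ∑ b, pd n b (V a) (f x) * jacobian n f x b μ)) := by
    intro μ
    rw [pd_mul_aux μ habs.differentiableAt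
      (DifferentiableAt.fun_sum fun a _ => (hKd μ a x).fun_mul (hVd a x)), hA,
      pd_sum_aux μ fun a => (hKd μ a x).fun_mul (hVd a x)]
    generalize (∑ i, ∑ k, jacobian n f_inv (f x) i k *
        pd n μ (fun y => jacobian n f y k i) x) = T
    rw [Finset.mul_sum, Finset.mul_sum, ← Finset.sum_add_distrib]
    refine Finset.sum_congr rfl fun a _ => ?_
    rw [pd_mul_aux μ (hKd μ a x) (hVd a x), pd_comp_aux μ (hV a (f x)) (hfd x)]
  simp only [hmain]
  rw [Finset.sum_comm, Finset.mul_sum]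
  refine Finset.sum_congr rfl fun a _ => ?_
  have h6 : ∑ μ, jacobian n f_inv (f x) μ a * ∑ b, pd n b (V a) (f x) * jacobian n f x b μ =
      pd n a (V a) (f x) := by
    simp only [Finset.mul_sum]
    rw [Finset.sum_comm]
    have h5 : ∀ b, ∑ d, jacobian n f x b d * jacobian n f_inv (f x) d a =
        (1 : Matrix (Fin n) (Fin n) ℝ) b a := fun b => by
      rw [← hJK x, Matrix.mul_apply]
    have h7 : ∀ b, ∑ μ, jacobian n f_inv (f x) μ a * (pd n b (V a) (f x) * jacobian n f x b μ) =
        pd n b (V a) (f x) * (1 : Matrix (Fin n) (Fin n) ℝ) b a := fun b => by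
      rw [← h5, Finset.mul_sum]
      exact Finset.sum_congr rfl fun _ _ => by ring
    simp [h7, Matrix.one_apply]
  rw [Finset.sum_add_distrib, ← Finset.mul_sum, Finset.sum_add_distrib, h6, ← Finset.sum_mul, hP]
  simp only [mul_assoc, ← Finset.mul_sum]
  simp only [← mul_assoc, ← Finset.sum_mul]
  ring

/-- Isometries of `g` act on solutions of Laplace's equation `Δ_g φ = 0`. -/
theorem isometry_acts_on_harmonic (n : ℕ)
    (g : (Fin n → ℝ) → Matrix (Fin n) (Fin n) ℝ)
    (hg : ∀ i j, ContDiff ℝ (⊤ : ℕ∞) fun x => g x i j)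
    (hsymm : ∀ x, (g x).IsSymm) (hpos : ∀ x, (g x).PosDef)
    (f f_inv : (Fin n → ℝ) → (Fin n → ℝ))
    (hf : ContDiff ℝ (⊤ : ℕ∞) f) (hf_inv : ContDiff ℝ (⊤ : ℕ∞) f_inv)
    (hleft : Function.LeftInverse f_inv f) (hright : Function.RightInverse f_inv f)
    (hiso : ∀ x, pullbackMet n f g x = g x)
    (φ : (Fin n → ℝ) → ℝ) (hφ : ContDiff ℝ (⊤ : ℕ∞) φ)
    (hharm : ∀ x, lapBel n g φ x = 0) :
    ∀ x, lapBel n g (φ ∘ f) x = 0 := by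
  have hfd : Differentiable ℝ f := hf.differentiable (by simp)
  have hfid : Differentiable ℝ f_inv := hf_inv.differentiable (by simp)
  have hφd : Differentiable ℝ φ := hφ.differentiable (by simp)
  have hKJ := jac_mul_aux hfd hfid hleft
  have hJK : ∀ y, jacobian n f y * jacobian n f_inv (f y) = 1 := fun y =>
    mul_eq_one_comm.1 (hKJ y)
  have hgd : ∀ i j, Differentiable ℝ (fun y => g y i j) := fun i j =>
    (hg i j).differentiable (by simp)
  have hdetpos : ∀ y, 0 < (g y).det := fun y => (hpos y).det_pos
  have hpd : ∀ ν, Differentiable ℝ (fun y => pd n ν φ y) := fun ν =>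
    ((hφ.fderiv_right (m := (⊤ : ℕ∞)) (by simp)).clm_apply contDiff_const).differentiable (by simp)
  set V : Fin n → (Fin n → ℝ) → ℝ := fun μ y =>
    Real.sqrt (g y).det * ∑ ν, (g y)⁻¹ μ ν * pd n ν φ y with hVdef
  have hV : ∀ a, Differentiable ℝ (V a) := by
    intro a y
    refine DifferentiableAt.mul ?_ ?_
    · exact (hasFDerivAt_det_aux fun i j => hgd i j y).differentiableAt.sqrt (hdetpos y).ne'
    · exact DifferentiableAt.fun_sum fun ν _ =>
        (diff_inv_aux (fun i j => hgd i j y) (hdetpos y).ne' a ν).mul (hpd ν y)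
  have hdiv : ∀ y, ∑ a, pd n a (V a) y = 0 := by
    intro y
    have := hharm y
    rw [lapBel, mul_eq_zero] at this
    rcases this with h | h
    · exact absurd h (inv_ne_zero (Real.sqrt_pos.2 (hdetpos y)).ne')
    · exact h
  have hsq : ∀ y, Real.sqrt (g y).det = |(jacobian n f y).det| * Real.sqrt (g (f y)).det := by
    intro y
    conv_lhs => rw [← hiso y, pullbackMet, Matrix.det_mul, Matrix.det_mul, Matrix.det_transpose]
    rw [← Real.sqrt_sq_eq_abs, ← Real.sqrt_mul (sq_nonneg _)]
    congr 1
    ring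
  have hinv : ∀ y, (g y)⁻¹ * (jacobian n f y)ᵀ = jacobian n f_inv (f y) * (g (f y))⁻¹ := by
    intro y
    have hu : IsUnit (g (f y)).det := (hdetpos _).ne'.isUnit
    have h1 : (jacobian n f y)ᵀ * (jacobian n f_inv (f y))ᵀ = 1 := by
      rw [← Matrix.transpose_mul, hKJ, Matrix.transpose_one]
    have h1' : (jacobian n f_inv (f y))ᵀ * (jacobian n f y)ᵀ = 1 := mul_eq_one_comm.1 h1
    have h2 : (g y)⁻¹ = jacobian n f_inv (f y) * (g (f y))⁻¹ * (jacobian n f_inv (f y))ᵀ := by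
      apply Matrix.inv_eq_right_inv
      rw [← hiso y, pullbackMet]
      calc _ = (jacobian n f y)ᵀ * (g (f y) * (jacobian n f y * jacobian n f_inv (f y)) *
            (g (f y))⁻¹) * (jacobian n f_inv (f y))ᵀ := by simp only [Matrix.mul_assoc]
        _ = 1 := by rw [hJK, Matrix.mul_one, Matrix.mul_nonsing_inv _ hu, Matrix.mul_one, h1]
    rw [h2, Matrix.mul_assoc, h1', Matrix.mul_one]
  have hW : ∀ μ, (fun y => Real.sqrt (g y).det * ∑ ν, (g y)⁻¹ μ ν * pd n ν (φ ∘ f) y) =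
      fun y => |(jacobian n f y).det| * ∑ a, jacobian n f_inv (f y) μ a * V a (f y) := by
    intro μ
    funext y
    have hc : ∀ ν, pd n ν (φ ∘ f) y = ((jacobian n f y)ᵀ *ᵥ fun b => pd n b φ (f y)) ν := by
      intro ν
      have := pd_comp_aux ν (hφd (f y)) (hfd y)
      refine this.trans ?_
      simp [Matrix.mulVec, dotProduct, mul_comm]
    have e1 : ∑ ν, (g y)⁻¹ μ ν * pd n ν (φ ∘ f) y =
        ((jacobian n f_inv (f y)) *ᵥ ((g (f y))⁻¹ *ᵥ fun b => pd n b φ (f y))) μ := by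
      simp only [hc]
      change ((g y)⁻¹ *ᵥ ((jacobian n f y)ᵀ *ᵥ fun b => pd n b φ (f y))) μ = _
      rw [Matrix.mulVec_mulVec, hinv, ← Matrix.mulVec_mulVec]
    rw [e1, hsq, mul_assoc]
    congr 1
    simp only [hVdef, Matrix.mulVec, dotProduct]
    rw [Finset.mul_sum]
    exact Finset.sum_congr rfl fun a _ => by ring
  intro x
  rw [lapBel]
  simp only [hW]
  rw [div_pull_aux hf hf_inv hleft V hV x, hdiv]
  simp
end

section
/- Let g : ℝⁿ → Matrix (Fin n) (Fin n) ℝ be C^∞ with g(x) symmetric and positive definite for every x, let f : ℝⁿ → ℝⁿ be a C^∞ diffeomorphism which is an isometry of g ((f*g)(x) = g(x) for all x), let φ : ℝⁿ → ℝ be C^∞, and let P : Polynomial ℝ be a real polynomial. If Δ_g φ(x) + P.eval(φ(x)) = 0 for all x, then Δ_g(φ ∘ f)(x) + P.eval((φ ∘ f)(x)) = 0 for all x. (The analogue of the isometry corollary for the interacting scalar field with polynomial potential, which the paper asserts follows by a nearly identical computation.) -/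
open Matrix

theorem pd_mul (n : ℕ) (μ : Fin n) (a b : (Fin n → ℝ) → ℝ) (x : Fin n → ℝ)
    (ha : DifferentiableAt ℝ a x) (hb : DifferentiableAt ℝ b x) :
    pd n μ (fun y => a y * b y) x = pd n μ a x * b x + a x * pd n μ b x := by
  unfold pd
  rw [fderiv_fun_mul ha hb]
  simp
  ring

theorem pd_sum (n : ℕ) (μ : Fin n) (a : Fin n → (Fin n → ℝ) → ℝ) (x : Fin n → ℝ)
    (ha : ∀ i, DifferentiableAt ℝ (a i) x) :
    pd n μ (fun y => ∑ i, a i y) x = ∑ i, pd n μ (a i) x := by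
  unfold pd
  rw [fderiv_fun_sum (fun i _ => ha i)]
  simp

theorem fderiv_eq_sum_pd (n : ℕ) (a : (Fin n → ℝ) → ℝ) (x v : Fin n → ℝ) :
    fderiv ℝ a x v = ∑ i, pd n i a x * v i := by
  unfold pd
  conv_lhs => rw [pi_eq_sum_univ' v]
  rw [map_sum]
  refine Finset.sum_congr rfl fun i _ => ?_
  rw [map_smul, smul_eq_mul, mul_comm]

theorem pd_comp (n : ℕ) (μ : Fin n) (a : (Fin n → ℝ) → ℝ) (f : (Fin n → ℝ) → (Fin n → ℝ))
    (x : Fin n → ℝ) (ha : DifferentiableAt ℝ a (f x)) (hf : DifferentiableAt ℝ f x) :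
    pd n μ (fun y => a (f y)) x = ∑ k, pd n k a (f x) * jacobian n f x k μ := by
  have h : fderiv ℝ (fun y => a (f y)) x = (fderiv ℝ a (f x)).comp (fderiv ℝ f x) :=
    fderiv_comp x ha hf
  rw [show pd n μ (fun y => a (f y)) x = fderiv ℝ (fun y => a (f y)) x (Pi.single μ 1) from rfl, h,
    ContinuousLinearMap.comp_apply, fderiv_eq_sum_pd]
  rfl

theorem contDiff_pd (n : ℕ) (μ : Fin n) (a : (Fin n → ℝ) → ℝ) (ha : ContDiff ℝ (⊤ : ℕ∞) a) :
    ContDiff ℝ (⊤ : ℕ∞) (pd n μ a) := by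
  unfold pd
  exact (ha.fderiv_right (m := (⊤ : ℕ∞)) (by simp)).clm_apply contDiff_const

theorem jacobian_eq_pd (n : ℕ) (f : (Fin n → ℝ) → (Fin n → ℝ)) (hf : Differentiable ℝ f)
    (x : Fin n → ℝ) (i j : Fin n) :
    jacobian n f x i j = pd n j (fun y => f y i) x := by
  simp only [jacobian, Matrix.of_apply, pd]
  rw [fderiv_apply (hf x)]
  rfl

theorem contDiff_jac (n : ℕ) (f : (Fin n → ℝ) → (Fin n → ℝ)) (hf : ContDiff ℝ (⊤ : ℕ∞) f)
    (i j : Fin n) : ContDiff ℝ (⊤ : ℕ∞) (fun x => jacobian n f x i j) := by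
  have : (fun x => jacobian n f x i j) = pd n j (fun y => f y i) := by
    ext x; exact jacobian_eq_pd n f (hf.differentiable (by simp)) x i j
  rw [this]
  exact contDiff_pd n j _ (contDiff_pi.1 hf i)

theorem pd_symm (n : ℕ) (μ ν : Fin n) (a : (Fin n → ℝ) → ℝ) (ha : ContDiff ℝ (⊤ : ℕ∞) a)
    (x : Fin n → ℝ) : pd n μ (pd n ν a) x = pd n ν (pd n μ a) x := by
  have hd : DifferentiableAt ℝ (fderiv ℝ a) x :=
    ((ha.fderiv_right (m := (⊤ : ℕ∞)) (by simp)).differentiable (by simp)) x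
  have hs : IsSymmSndFDerivAt ℝ a x :=
    ha.contDiffAt.isSymmSndFDerivAt (by simp only [minSmoothness_of_isRCLikeNormedField]; exact WithTop.coe_le_coe.2 (le_top : (2 : ℕ∞) ≤ ⊤))
  have key : ∀ v w, fderiv ℝ (fun y => fderiv ℝ a y v) x w = fderiv ℝ (fderiv ℝ a) x w v := by
    intro v w
    rw [fderiv_clm_apply hd (differentiableAt_const _)]
    simp
  show fderiv ℝ (fun y => fderiv ℝ a y _) x _ = fderiv ℝ (fun y => fderiv ℝ a y _) x _
  rw [key, key]
  exact hs _ _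

theorem contDiff_det (n : ℕ) (M : (Fin n → ℝ) → Matrix (Fin n) (Fin n) ℝ)
    (hM : ∀ i j, ContDiff ℝ (⊤ : ℕ∞) fun x => M x i j) :
    ContDiff ℝ (⊤ : ℕ∞) fun x => (M x).det := by
  simp only [Matrix.det_apply']
  refine ContDiff.sum fun σ _ => contDiff_const.mul (contDiff_prod fun i _ => hM _ _)

theorem contDiff_adj (n : ℕ) (M : (Fin n → ℝ) → Matrix (Fin n) (Fin n) ℝ)
    (hM : ∀ i j, ContDiff ℝ (⊤ : ℕ∞) fun x => M x i j) (a b : Fin n) :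
    ContDiff ℝ (⊤ : ℕ∞) fun x => (M x).adjugate a b := by
  simp only [Matrix.adjugate_apply]
  refine contDiff_det n _ fun i j => ?_
  simp only [Matrix.updateRow_apply]
  split_ifs
  · exact contDiff_const
  · exact hM i j

theorem pd_det (n : ℕ) (M : (Fin n → ℝ) → Matrix (Fin n) (Fin n) ℝ)
    (hM : ∀ i j, Differentiable ℝ fun x => M x i j) (c : Fin n) (x : Fin n → ℝ) :
    pd n c (fun y => (M y).det) x
      = ∑ b, ∑ a, (M x).adjugate a b * pd n c (fun y => M y b a) x := by
  let D : ContinuousMultilinearMap ℝ (fun _ : Fin n => Fin n → ℝ) ℝ :=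
    { (Matrix.detRowAlternating (n := Fin n) (R := ℝ)).toMultilinearMap with
      cont := by
        show Continuous fun A : Fin n → Fin n → ℝ => Matrix.det (Matrix.of A)
        exact Continuous.matrix_det (continuous_id) }
  have hD : ∀ A : Fin n → Fin n → ℝ, D A = Matrix.det (Matrix.of A) := fun A => rfl
  have hrow : ∀ i, HasFDerivAt (fun y => (M y) i) (fderiv ℝ (fun y => (M y) i) x) x := fun i =>
    (differentiableAt_pi.2 (fun j => hM i j x)).hasFDerivAt
  have h := HasFDerivAt.multilinear_comp (f := D) (g := fun i y => (M y) i) hrow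
  have h2 : (fun y => (M y).det) = fun y => D (fun i => M y i) := by
    ext y; rfl
  unfold pd
  rw [h2, h.fderiv]
  simp only [_root_.sum_apply, ContinuousLinearMap.comp_apply]
  refine Finset.sum_congr rfl fun b _ => ?_
  have e : ∀ v : Fin n → ℝ, D.toContinuousLinearMap (fun i => M x i) b v
      = ∑ a, (M x).adjugate a b * v a := by
    intro v
    have : D.toContinuousLinearMap (fun i => M x i) b v = ((M x).updateRow b v).det := rfl
    rw [this, ← Matrix.cramer_transpose_apply, Matrix.cramer_eq_adjugate_mulVec,
      ← Matrix.adjugate_transpose]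
    rfl
  rw [e]
  refine Finset.sum_congr rfl fun a _ => ?_
  congr 1
  rw [fderiv_apply (hrow b).differentiableAt a]
  rfl

/-- Piola identity. -/
theorem piola (n : ℕ) (f : (Fin n → ℝ) → (Fin n → ℝ)) (hf : ContDiff ℝ (⊤ : ℕ∞) f)
    (x : Fin n → ℝ) (hdet : (jacobian n f x).det ≠ 0) (i : Fin n) :
    ∑ μ, pd n μ (fun y => (jacobian n f y).adjugate μ i) x = 0 := by
  have hJ := contDiff_jac n f hf
  have hJd : ∀ i j, Differentiable ℝ fun x => jacobian n f x i j :=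
    fun i j => (hJ i j).differentiable (by simp)
  have hAd : ∀ i j, Differentiable ℝ fun x => (jacobian n f x).adjugate i j :=
    fun i j => (contDiff_adj n _ hJ i j).differentiable (by simp)
  have hdd : Differentiable ℝ fun x => (jacobian n f x).det :=
    (contDiff_det n _ hJ).differentiable (by simp)
  have hsym : ∀ μ c b, pd n μ (fun y => jacobian n f y b c) x
      = pd n c (fun y => jacobian n f y b μ) x := by
    intro μ c b
    have : ∀ c, (fun x => jacobian n f x b c) = pd n c (fun y => f y b) := fun c => by
      ext x; exact jacobian_eq_pd n f (hf.differentiable (by simp)) x b c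
    rw [this, this]
    exact pd_symm n _ _ _ (contDiff_pi.1 hf b) x
  set w : Fin n → ℝ := fun b => ∑ μ, pd n μ (fun y => (jacobian n f y).adjugate μ b) x with hw
  have hwJ : w ᵥ* jacobian n f x = 0 := by
    ext c
    have h1 : ∀ μ, ∑ b, (pd n μ (fun y => (jacobian n f y).adjugate μ b) x * jacobian n f x b c
        + (jacobian n f x).adjugate μ b * pd n μ (fun y => jacobian n f y b c) x)
        = if μ = c then pd n μ (fun y => (jacobian n f y).det) x else 0 := by
      intro μ
      have e1 : (fun y => ∑ b, (jacobian n f y).adjugate μ b * jacobian n f y b c)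
          = fun y => if μ = c then (jacobian n f y).det else 0 := by
        ext y
        have := congrFun (congrFun (Matrix.adjugate_mul (jacobian n f y)) μ) c
        rw [Matrix.mul_apply] at this
        rw [this]
        simp [Matrix.one_apply]
      have e2 := congrArg (fun F => pd n μ F x) e1
      rw [pd_sum n μ (fun b y => (jacobian n f y).adjugate μ b * jacobian n f y b c) x
        (fun b => ((hAd μ b).mul (hJd b c)) x)] at e2
      rw [← Finset.sum_congr rfl
        (fun b _ => pd_mul n μ _ _ x (hAd μ b x) (hJd b c x)), e2]
      split_ifs
      · rfl
      · simp [pd]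
    have h2 := Finset.sum_congr (rfl : (Finset.univ : Finset (Fin n)) = Finset.univ)
      (fun μ _ => h1 μ)
    simp only [Finset.sum_add_distrib, Finset.sum_ite_eq', Finset.mem_univ, if_true] at h2
    rw [pd_det n _ hJd] at h2
    have h3 : ∑ μ, ∑ b, (jacobian n f x).adjugate μ b * pd n μ (fun y => jacobian n f y b c) x
        = ∑ b, ∑ a, (jacobian n f x).adjugate a b * pd n c (fun y => jacobian n f y b a) x := by
      rw [Finset.sum_comm]
      refine Finset.sum_congr rfl fun b _ => Finset.sum_congr rfl fun a _ => ?_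
      rw [hsym a c b]
    rw [h3, Finset.sum_comm] at h2
    have h4 : (w ᵥ* jacobian n f x) c = ∑ b, ∑ μ,
        pd n μ (fun y => (jacobian n f y).adjugate μ b) x * jacobian n f x b c := by
      simp only [Matrix.vecMul, dotProduct, hw, Finset.sum_mul]
    rw [h4]
    simpa using h2
  have := Matrix.eq_zero_of_vecMul_eq_zero hdet hwJ
  exact congrFun this i

/-- Naturality of the Laplace–Beltrami operator under isometries. -/
theorem lapBel_comp (n : ℕ)
    (g : (Fin n → ℝ) → Matrix (Fin n) (Fin n) ℝ)
    (hg : ∀ i j, ContDiff ℝ (⊤ : ℕ∞) fun x => g x i j)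
    (hpos : ∀ x, (g x).PosDef)
    (f : (Fin n → ℝ) → (Fin n → ℝ)) (hf : ContDiff ℝ (⊤ : ℕ∞) f)
    (hiso : ∀ x, pullbackMet n f g x = g x)
    (φ : (Fin n → ℝ) → ℝ) (hφ : ContDiff ℝ (⊤ : ℕ∞) φ) (x : Fin n → ℝ) :
    lapBel n g (φ ∘ f) x = lapBel n g φ (f x) := by
  have hJ := contDiff_jac n f hf
  have hAd : ∀ i j, Differentiable ℝ fun x => (jacobian n f x).adjugate i j :=
    fun i j => (contDiff_adj n _ hJ i j).differentiable (by simp)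
  have hdc : Continuous fun x => (jacobian n f x).det := (contDiff_det n _ hJ).continuous
  have hfd : Differentiable ℝ f := hf.differentiable (by simp)
  have hφd : Differentiable ℝ φ := hφ.differentiable (by simp)
  have hdetpos : ∀ y, 0 < (g y).det := fun y => (hpos y).det_pos
  have hdetg : ∀ y, (g y).det = (jacobian n f y).det ^ 2 * (g (f y)).det := by
    intro y
    conv_lhs => rw [← hiso y]
    simp only [pullbackMet, Matrix.det_mul, Matrix.det_transpose]
    ring
  have hJ0 : ∀ y, (jacobian n f y).det ≠ 0 := by
    intro y h
    have := hdetpos y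
    rw [hdetg y, h] at this
    simp at this
  have hsq : ∀ y, Real.sqrt (g y).det = |(jacobian n f y).det| * Real.sqrt (g (f y)).det := by
    intro y
    rw [hdetg y, Real.sqrt_mul (sq_nonneg _), Real.sqrt_sq_eq_abs]
  -- the flux
  set W : Fin n → (Fin n → ℝ) → ℝ :=
    fun i y => Real.sqrt (g y).det * ∑ ν, (g y)⁻¹ i ν * pd n ν φ y with hW
  have hWd : ∀ i, Differentiable ℝ (W i) := by
    intro i
    have hdetC := contDiff_det n g hg
    have h1 : Differentiable ℝ fun y => Real.sqrt (g y).det := fun y =>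
      ((hdetC.differentiable (by simp)) y).sqrt (hdetpos y).ne'
    have h2 : ∀ ν, Differentiable ℝ fun y => (g y)⁻¹ i ν := by
      intro ν
      have : (fun y => (g y)⁻¹ i ν) = fun y => ((g y).det)⁻¹ * (g y).adjugate i ν := by
        ext y
        rw [Matrix.inv_def, Ring.inverse_eq_inv']
        rfl
      rw [this]
      exact fun y => (((hdetC.differentiable (by simp)) y).inv (hdetpos y).ne').mul
        (((contDiff_adj n g hg i ν).differentiable (by simp)) y)
    have h3 : ∀ ν, Differentiable ℝ (pd n ν φ) := fun ν =>
      (contDiff_pd n ν φ hφ).differentiable (by simp)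
    exact h1.mul (Differentiable.fun_sum fun ν _ => (h2 ν).mul (h3 ν))
  -- pointwise transformation of the flux
  have hV : ∀ μ y, Real.sqrt (g y).det * ∑ ν, (g y)⁻¹ μ ν * pd n ν (φ ∘ f) y
      = SignType.sign (jacobian n f y).det *
        ∑ i, (jacobian n f y).adjugate μ i * W i (f y) := by
    intro μ y
    have hu : IsUnit (jacobian n f y).det := (hJ0 y).isUnit
    have hgrad : (fun ν => pd n ν (φ ∘ f) y)
        = (jacobian n f y)ᵀ *ᵥ (fun k => pd n k φ (f y)) := by
      ext ν
      have := pd_comp n ν φ f y (hφd _) (hfd y)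
      simp only [Matrix.mulVec, dotProduct, Matrix.transpose_apply]
      refine this.trans (Finset.sum_congr rfl fun k _ => mul_comm _ _)
    have hinv : (g y)⁻¹ * (jacobian n f y)ᵀ = (jacobian n f y)⁻¹ * (g (f y))⁻¹ := by
      have hu' : IsUnit ((jacobian n f y)ᵀ).det := by rwa [Matrix.det_transpose]
      conv_lhs => rw [← hiso y]
      rw [pullbackMet, Matrix.mul_inv_rev, Matrix.mul_inv_rev, Matrix.mul_assoc, Matrix.mul_assoc,
        Matrix.nonsing_inv_mul _ hu', Matrix.mul_one]
    have e1 : ∑ ν, (g y)⁻¹ μ ν * pd n ν (φ ∘ f) y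
        = ((jacobian n f y)⁻¹ *ᵥ ((g (f y))⁻¹ *ᵥ (fun k => pd n k φ (f y)))) μ := by
      rw [Matrix.mulVec_mulVec, ← hinv, ← Matrix.mulVec_mulVec, ← hgrad]
      rfl
    have e2 : ∀ v : Fin n → ℝ, ((jacobian n f y)⁻¹ *ᵥ v) μ
        = ((jacobian n f y).det)⁻¹ * ∑ i, (jacobian n f y).adjugate μ i * v i := by
      intro v
      rw [Matrix.inv_def, Ring.inverse_eq_inv', Matrix.smul_mulVec]
      rfl
    have e3 : ∀ i, W i (f y) = Real.sqrt (g (f y)).det *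
        ((g (f y))⁻¹ *ᵥ (fun k => pd n k φ (f y))) i := fun i => rfl
    rw [e1, e2, hsq y]
    simp only [e3]
    have e4 : |(jacobian n f y).det| * ((jacobian n f y).det)⁻¹
        = SignType.sign (jacobian n f y).det := by
      rw [← sign_mul_self (jacobian n f y).det, mul_assoc, mul_inv_cancel₀ (hJ0 y), mul_one]
    rw [← e4, Finset.mul_sum, Finset.mul_sum, Finset.mul_sum]
    refine Finset.sum_congr rfl fun i _ => ?_
    ring
  have hloc : ∀ᶠ y in nhds x, SignType.sign (jacobian n f y).det
      = SignType.sign (jacobian n f x).det := by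
    rcases lt_or_gt_of_ne (hJ0 x) with h | h
    · filter_upwards [hdc.continuousAt.eventually_lt continuousAt_const h] with y hy
      rw [sign_neg hy, sign_neg h]
    · filter_upwards [continuousAt_const.eventually_lt hdc.continuousAt h] with y hy
      rw [sign_pos hy, sign_pos h]
  obtain ⟨ε, hε⟩ : ∃ e : ℝ, e = ((SignType.sign (jacobian n f x).det : SignType) : ℝ) := ⟨_, rfl⟩
  have hWf : ∀ i, DifferentiableAt ℝ (fun y => W i (f y)) x := fun i => 
    (hWd i (f x)).comp x (hfd x)
  have hpdV : ∀ μ, pd n μ (fun y => Real.sqrt (g y).det * ∑ ν, (g y)⁻¹ μ ν * pd n ν (φ ∘ f) y) x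
      = ε * ∑ i, (pd n μ (fun y => (jacobian n f y).adjugate μ i) x * W i (f x)
        + (jacobian n f x).adjugate μ i * ∑ k, pd n k (W i) (f x) * jacobian n f x k μ) := by
    intro μ
    have heq : (fun y => Real.sqrt (g y).det * ∑ ν, (g y)⁻¹ μ ν * pd n ν (φ ∘ f) y)
        =ᶠ[nhds x] fun y => ε * ∑ i, (jacobian n f y).adjugate μ i * W i (f y) := by
      filter_upwards [hloc] with y hy
      rw [hV μ y, hy, hε]
    have hd : ∀ i, DifferentiableAt ℝ (fun y => (jacobian n f y).adjugate μ i * W i (f y)) x :=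
      fun i => (hAd μ i x).mul (hWf i)
    have h0 : pd n μ (fun y => Real.sqrt (g y).det * ∑ ν, (g y)⁻¹ μ ν * pd n ν (φ ∘ f) y) x
        = pd n μ (fun y => ε * ∑ i, (jacobian n f y).adjugate μ i * W i (f y)) x := by
      unfold pd at heq ⊢
      rw [heq.fderiv_eq]
    rw [h0, pd_mul n μ (fun _ => ε) _ x (differentiableAt_const _)
      (DifferentiableAt.fun_sum fun i _ => hd i), pd_sum n μ _ x hd]
    have : pd n μ (fun _ => ε) x = 0 := by simp [pd]
    rw [this, zero_mul, zero_add]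
    congr 1
    refine Finset.sum_congr rfl fun i _ => ?_
    rw [pd_mul n μ _ _ x (hAd μ i x) (hWf i), pd_comp n μ (W i) f x (hWd i _) (hfd x)]
  have hdiv : ∑ μ, ∑ i, (pd n μ (fun y => (jacobian n f y).adjugate μ i) x * W i (f x)
        + (jacobian n f x).adjugate μ i * ∑ k, pd n k (W i) (f x) * jacobian n f x k μ)
      = (jacobian n f x).det * ∑ i, pd n i (W i) (f x) := by
    rw [Finset.sum_comm, Finset.mul_sum]
    refine Finset.sum_congr rfl fun i _ => ?_
    rw [Finset.sum_add_distrib, ← Finset.sum_mul, piola n f hf x (hJ0 x) i, zero_mul, zero_add]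
    simp only [Finset.mul_sum]
    rw [Finset.sum_comm]
    have h : ∀ k, ∑ μ, (jacobian n f x).adjugate μ i * (pd n k (W i) (f x) * jacobian n f x k μ)
        = pd n k (W i) (f x) * (if k = i then (jacobian n f x).det else 0) := by
      intro k
      have := congrFun (congrFun (Matrix.mul_adjugate (jacobian n f x)) k) i
      rw [Matrix.mul_apply] at this
      have h' : (if k = i then (jacobian n f x).det else 0)
          = ((jacobian n f x).det • (1 : Matrix (Fin n) (Fin n) ℝ)) k i := by
        simp [Matrix.one_apply]
      rw [h', ← this, Finset.mul_sum]
      refine Finset.sum_congr rfl fun μ _ => ?_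
      ring
    simp only [h]
    simp [mul_comm]
  have hL : lapBel n g φ (f x) = (Real.sqrt (g (f x)).det)⁻¹ * ∑ i, pd n i (W i) (f x) := rfl
  rw [hL]
  unfold lapBel
  simp only [hpdV]
  rw [← Finset.mul_sum, hdiv, hsq x]
  have e5 : ε * (jacobian n f x).det = |(jacobian n f x).det| := by
    rw [hε]; exact sign_mul_self _
  rw [← mul_assoc ε, e5]
  have : |(jacobian n f x).det| ≠ 0 := abs_ne_zero.2 (hJ0 x)
  rw [mul_inv]
  field_simp

/-- Isometries of `g` act on solutions of the interacting equation of motion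
`Δ_g φ + P(φ) = 0` for a polynomial potential `P`. -/
theorem isometry_acts_on_solutions_polynomial (n : ℕ)
    (g : (Fin n → ℝ) → Matrix (Fin n) (Fin n) ℝ)
    (hg : ∀ i j, ContDiff ℝ (⊤ : ℕ∞) fun x => g x i j)
    (hsymm : ∀ x, (g x).IsSymm) (hpos : ∀ x, (g x).PosDef)
    (f f_inv : (Fin n → ℝ) → (Fin n → ℝ))
    (hf : ContDiff ℝ (⊤ : ℕ∞) f) (hf_inv : ContDiff ℝ (⊤ : ℕ∞) f_inv)
    (hleft : Function.LeftInverse f_inv f) (hright : Function.RightInverse f_inv f)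
    (hiso : ∀ x, pullbackMet n f g x = g x)
    (φ : (Fin n → ℝ) → ℝ) (hφ : ContDiff ℝ (⊤ : ℕ∞) φ) (P : Polynomial ℝ)
    (hsol : ∀ x, lapBel n g φ x + P.eval (φ x) = 0) :
    ∀ x, lapBel n g (φ ∘ f) x + P.eval ((φ ∘ f) x) = 0 := by
  intro x
  rw [lapBel_comp n g hg hpos f hf hiso φ hφ x]
  exact hsol (f x)
end
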